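/- For effective (trace-free) double forms ω₁ ∈ E^{r,r} and ω₂ ∈ E^{s,s} on an n-dimensional Euclidean space: ⟨g^p ω₁, g^q ω₂⟩ = 0 whenever p ≠ q, or p = q and r ≠ s; and when p = q ≥ 1 and r = s, ⟨g^p ω₁, g^p ω₂⟩ = p!·∏_{i=0}^{p−1}(n − 2r − i)·⟨ω₁, ω₂⟩. -/

import Mathlib

open Finset

noncomputable section

/-- Double forms on the Euclidean space `ℝⁿ`: elements of `Λᵖ(ℝⁿ)* ⊗ Λ^q(ℝⁿ)*`,
represented by their (antisymmetric) coefficient arrays in the standard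
orthonormal basis. -/
abbrev DForm (n p q : ℕ) := (Fin p → Fin n) → (Fin q → Fin n) → ℝ

/-- Transport of a double form along equalities of the bidegree. -/
def castD {n p q p' q' : ℕ} (hp : p = p') (hq : q = q') (ω : DForm n p q) :
    DForm n p' q' :=
  fun x y => ω (x ∘ Fin.cast hp) (y ∘ Fin.cast hq)

/-- The product in the ring of double forms: the exterior product taken
simultaneously on both factors. -/
def dmul {n p q r s : ℕ} (ω : DForm n p q) (η : DForm n r s) :
    DForm n (p + r) (q + s) :=
  fun x y =>
    (1 / ((p.factorial * r.factorial * q.factorial * s.factorial : ℕ) : ℝ)) *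
      ∑ σ : Equiv.Perm (Fin (p + r)), ∑ τ : Equiv.Perm (Fin (q + s)),
        ((Equiv.Perm.sign σ : ℤ) : ℝ) * ((Equiv.Perm.sign τ : ℤ) : ℝ) *
          (ω (fun i => x (σ (Fin.castAdd r i))) (fun j => y (τ (Fin.castAdd s j))) *
           η (fun i => x (σ (Fin.natAdd p i))) (fun j => y (τ (Fin.natAdd q j))))

/-- The metric `g` of `ℝⁿ` as a double form of bidegree `(1,1)` (the identity
element of the contraction: the Kronecker delta). -/
def gform (n : ℕ) : DForm n 1 1 := fun x y => if x 0 = y 0 then 1 else 0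

/-- Powers `g^k` of the metric in the ring of double forms. -/
def gpow (n : ℕ) : (k : ℕ) → DForm n k k
  | 0 => fun _ _ => 1
  | k + 1 => castD (Nat.add_comm 1 k) (Nat.add_comm 1 k) (dmul (gform n) (gpow n k))

/-- The contraction map `c : D^{p+1,q+1} → D^{p,q}`. -/
def contr {n p q : ℕ} (ω : DForm n (p + 1) (q + 1)) : DForm n p q :=
  fun x y => ∑ j : Fin n, ω (Fin.cons j x) (Fin.cons j y)

/-- The natural inner product on `D^{p,q}` (for which the increasing basis
monomials are orthonormal). -/
def dinner {n p q : ℕ} (ω₁ ω₂ : DForm n p q) : ℝ :=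
  (1 / ((p.factorial * q.factorial : ℕ) : ℝ)) *
    ∑ x : Fin p → Fin n, ∑ y : Fin q → Fin n, ω₁ x y * ω₂ x y

/-- A coefficient array represents a double form iff it is antisymmetric in each
group of arguments. -/
def IsAlt {n p q : ℕ} (ω : DForm n p q) : Prop :=
  (∀ (σ : Equiv.Perm (Fin p)) (x : Fin p → Fin n) (y : Fin q → Fin n),
      ω (x ∘ σ) y = ((Equiv.Perm.sign σ : ℤ) : ℝ) * ω x y) ∧
  (∀ (τ : Equiv.Perm (Fin q)) (x : Fin p → Fin n) (y : Fin q → Fin n),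
      ω x (y ∘ τ) = ((Equiv.Perm.sign τ : ℤ) : ℝ) * ω x y)

/-- A double form in `D^{p,p}` is symmetric if it is invariant under exchanging
the two factors. -/
def IsSym {n p : ℕ} (ω : DForm n p p) : Prop := ∀ x y, ω x y = ω y x

/-- The first Bianchi map sends `D^{p,q+1}` to `D^{p+1,q}`; a double form satisfies
the first Bianchi identity when it lies in its kernel. -/
def FirstBianchi {n p q : ℕ} (ω : DForm n p (q + 1)) : Prop :=
  ∀ (x : Fin (p + 1) → Fin n) (y : Fin q → Fin n),
    ∑ k : Fin (p + 1),
      (-1 : ℝ) ^ (k : ℕ) * ω (x ∘ Fin.succAbove k) (Fin.cons (x k) y) = 0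

/-- The sign of a family `(f i)` of indices: the signature of `f` viewed as a
permutation if it is bijective, and `0` otherwise (Levi-Civita symbol). -/
def eps {n : ℕ} (f : Fin n → Fin n) : ℝ :=
  if h : Function.Bijective f then
    ((Equiv.Perm.sign (Equiv.ofBijective f h) : ℤ) : ℝ)
  else 0

/-- The Hodge star operator on double forms, acting as the usual Hodge star
simultaneously on both factors. -/
def dstar {n p q : ℕ} (hp : p ≤ n) (hq : q ≤ n) (ω : DForm n p q) :
    DForm n (n - p) (n - q) :=
  fun x y =>
    (1 / ((p.factorial * q.factorial : ℕ) : ℝ)) *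
      ∑ u : Fin p → Fin n, ∑ v : Fin q → Fin n,
        eps (fun i => Fin.append u x (Fin.cast (by omega) i)) *
        eps (fun i => Fin.append v y (Fin.cast (by omega) i)) * ω u v

/-- Antisymmetry of a single group of arguments. -/
def IsAltFn {n k : ℕ} (f : (Fin k → Fin n) → ℝ) : Prop :=
  ∀ (σ : Equiv.Perm (Fin k)) (x : Fin k → Fin n),
    f (x ∘ σ) = ((Equiv.Perm.sign σ : ℤ) : ℝ) * f x

lemma cons_succAbove_eq_comp {n k : ℕ} (x : Fin (k + 1) → Fin n) (i : Fin (k + 1)) :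
    (Fin.cons (x i) (x ∘ i.succAbove) : Fin (k + 1) → Fin n) = x ∘ i.cycleRange.symm := by
  funext j
  refine Fin.cases ?_ (fun j => ?_) j <;> simp

lemma insertNth_comp_cycleRange_symm {n k : ℕ} (i : Fin (k + 1)) (m : Fin n)
    (u : Fin k → Fin n) :
    (i.insertNth m u : Fin (k + 1) → Fin n) ∘ i.cycleRange.symm = Fin.cons m u := by
  rw [← cons_succAbove_eq_comp]
  funext j
  refine Fin.cases ?_ (fun j => ?_) j <;> simp

lemma cons_comp_succAbove_succ {n k : ℕ} (m : Fin n) (x : Fin (k + 1) → Fin n)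
    (i : Fin (k + 1)) :
    (Fin.cons m x : Fin (k + 2) → Fin n) ∘ i.succ.succAbove = Fin.cons m (x ∘ i.succAbove) := by
  funext j
  refine Fin.cases ?_ (fun j => ?_) j <;> simp

lemma sign_cycleRange_symm_cast {k : ℕ} (i : Fin k) :
    ((Equiv.Perm.sign i.cycleRange.symm : ℤ) : ℝ) = (-1) ^ (i : ℕ) := by
  simp [Equiv.Perm.sign_symm, Fin.sign_cycleRange]

lemma sign_mul_self_cast {k : ℕ} (σ : Equiv.Perm (Fin k)) :
    ((Equiv.Perm.sign σ : ℤ) : ℝ) * ((Equiv.Perm.sign σ : ℤ) : ℝ) = 1 := by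
  rcases Int.units_eq_one_or (Equiv.Perm.sign σ) with h | h <;> simp [h]

lemma IsAltFn.cons_succAbove {n k : ℕ} {f : (Fin (k + 1) → Fin n) → ℝ} (hf : IsAltFn f)
    (x : Fin (k + 1) → Fin n) (i : Fin (k + 1)) :
    f (Fin.cons (x i) (x ∘ i.succAbove)) = (-1) ^ (i : ℕ) * f x := by
  rw [cons_succAbove_eq_comp, hf, sign_cycleRange_symm_cast]

lemma IsAltFn.insertNth {n k : ℕ} {f : (Fin (k + 1) → Fin n) → ℝ} (hf : IsAltFn f)
    (i : Fin (k + 1)) (m : Fin n) (u : Fin k → Fin n) :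
    f (i.insertNth m u) = (-1) ^ (i : ℕ) * f (Fin.cons m u) := by
  rw [← insertNth_comp_cycleRange_symm i, hf, sign_cycleRange_symm_cast, ← mul_assoc, ← mul_pow]
  simp

lemma IsAltFn.sum_cons_succAbove {n k : ℕ} {f : (Fin (k + 1) → Fin n) → ℝ} (hf : IsAltFn f)
    (x : Fin (k + 1) → Fin n) :
    ∑ i : Fin (k + 1), (-1) ^ (i : ℕ) * f (Fin.cons (x i) (x ∘ i.succAbove)) =
      (k + 1) * f x := by
  simp [hf.cons_succAbove, ← mul_assoc, ← mul_pow]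

/-- A permutation of `Fin (k + 1)` fixing `0` acts on the remaining arguments by a permutation
of the same sign. -/
lemma exists_perm_of_apply_zero {k : ℕ} (h : Equiv.Perm (Fin (k + 1))) (h0 : h 0 = 0) :
    ∃ π : Equiv.Perm (Fin k), Equiv.Perm.sign π = Equiv.Perm.sign h ∧
      ∀ j, h (Fin.succ j) = (π j).succ := by
  obtain ⟨⟨p, π⟩, rfl⟩ := Equiv.Perm.decomposeFin.symm.surjective h
  rw [Equiv.Perm.decomposeFin_symm_apply_zero] at h0
  subst h0
  exact ⟨π, by simp [Equiv.Perm.decomposeFin.symm_sign],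
    fun j => by simp [Equiv.Perm.decomposeFin_symm_apply_succ]⟩

lemma isAltFn_sum_succAbove {n k : ℕ} (f : Fin n → (Fin k → Fin n) → ℝ)
    (hf : ∀ m, IsAltFn (f m)) :
    IsAltFn fun x : Fin (k + 1) → Fin n =>
      ∑ i : Fin (k + 1), (-1) ^ (i : ℕ) * f (x i) (x ∘ i.succAbove) := by
  intro σ x
  dsimp only
  conv_rhs => rw [← Equiv.sum_comp σ, mul_sum]
  refine sum_congr rfl fun i _ => ?_
  set h : Equiv.Perm (Fin (k + 1)) := (σ i).cycleRange * (σ * i.cycleRange.symm) with hh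
  obtain ⟨π, hs, hπ⟩ := exists_perm_of_apply_zero h (by simp [hh])
  have key : (x ∘ σ) ∘ i.succAbove = (x ∘ (σ i).succAbove) ∘ π := by
    funext j
    have : (σ i).cycleRange (σ (i.succAbove j)) = (π j).succ := by
      rw [← hπ]; simp [hh]
    simp only [Function.comp_apply]
    rw [← Fin.cycleRange_symm_succ (σ i), ← this, Equiv.symm_apply_apply]
  rw [key, hf, hs, hh, Equiv.Perm.sign_mul, Equiv.Perm.sign_mul]
  have h1 := sign_cycleRange_symm_cast i
  rw [Fin.sign_cycleRange]
  push_cast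
  rw [h1]
  have h2 : ((-1 : ℝ) ^ (i : ℕ)) * (-1) ^ (i : ℕ) = 1 := by simp [← mul_pow]
  simp only [Function.comp_apply]
  linear_combination ((-1 : ℝ) ^ (σ i : ℕ) * ((Equiv.Perm.sign σ : ℤ) : ℝ) *
    f (x (σ i)) ((x ∘ (σ i).succAbove))) * h2

/-- Multiplication by the metric, in the form of an explicit expansion. -/
def gwedge {n k : ℕ} (η : DForm n k k) : DForm n (k + 1) (k + 1) := fun x y =>
  ∑ i : Fin (k + 1), ∑ j : Fin (k + 1), (-1) ^ (i : ℕ) * ((-1) ^ (j : ℕ) *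
    ((if x i = y j then 1 else 0) * η (x ∘ i.succAbove) (y ∘ j.succAbove)))

lemma IsAlt.gwedge {n k : ℕ} {η : DForm n k k} (hη : IsAlt η) : IsAlt (gwedge η) := by
  constructor
  · intro σ x y
    have := isAltFn_sum_succAbove (fun m u => ∑ j : Fin (k + 1), (-1) ^ (j : ℕ) *
      ((if m = y j then 1 else 0) * η u (y ∘ j.succAbove))) (fun m π u => by
        rw [mul_sum]; refine sum_congr rfl fun j _ => ?_; rw [hη.1]; ring) σ x
    simpa only [_root_.gwedge, mul_sum] using this
  · intro σ x y
    have := isAltFn_sum_succAbove (fun m v => ∑ i : Fin (k + 1), (-1) ^ (i : ℕ) *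
      ((if x i = m then 1 else 0) * η (x ∘ i.succAbove) v)) (fun m π u => by
        rw [mul_sum]; refine sum_congr rfl fun j _ => ?_; rw [hη.2]; ring) σ y
    simp only [_root_.gwedge]
    rw [sum_comm]
    conv_rhs => rw [sum_comm]
    simp only [mul_sum, mul_left_comm] at this ⊢
    exact this

lemma IsAlt.contr {n p q : ℕ} {η : DForm n (p + 1) (q + 1)} (hη : IsAlt η) :
    IsAlt (contr η) := by
  have key : ∀ {k : ℕ} (σ : Equiv.Perm (Fin k)) (m : Fin n) (x : Fin k → Fin n),
      (Fin.cons m (x ∘ σ) : Fin (k + 1) → Fin n) =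
        Fin.cons m x ∘ Equiv.Perm.decomposeFin.symm (0, σ) := by
    intro k σ m x
    funext j
    refine Fin.cases ?_ (fun j => ?_) j <;> simp
  constructor <;> intro σ x y <;> simp only [_root_.contr, mul_sum, key, hη.1, hη.2] <;>
    simp [Equiv.Perm.decomposeFin.symm_sign]

lemma IsAlt.castD {n p q p' q' : ℕ} {ω : DForm n p q} (h : IsAlt ω) (hp : p = p')
    (hq : q = q') : IsAlt (castD hp hq ω) := by
  subst hp hq
  exact h

lemma isAlt_zero {n p q : ℕ} : IsAlt (0 : DForm n p q) := by
  constructor <;> simp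

lemma contr_gwedge_zero {n : ℕ} (η : DForm n 0 0) : contr (gwedge η) = (n : ℝ) • η := by
  funext x y
  have h (z : Fin 0 → Fin n) (w : Fin 0 → Fin n) : η z w = η x y := by
    rw [Subsingleton.elim z x, Subsingleton.elim w y]
  simp [contr, gwedge, h]

lemma contr_gwedge_succ {n k : ℕ} {η : DForm n (k + 1) (k + 1)} (hη : IsAlt η) :
    contr (gwedge η) = ((n : ℝ) - 2 * (k + 1 : ℕ)) • η + gwedge (contr η) := by
  funext x y
  have h1 : IsAltFn fun x => η x y := fun σ x => hη.1 σ x y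
  have h2 : IsAltFn fun y => η x y := fun σ y => hη.2 σ x y
  have e1 := h1.sum_cons_succAbove x
  have e2 := h2.sum_cons_succAbove y
  simp only [contr, gwedge, Fin.sum_univ_succ (n := k + 1), cons_comp_succAbove_succ,
    Fin.cons_zero, Fin.cons_succ, Fin.val_succ, Fin.val_zero, sum_add_distrib, Pi.add_apply,
    Pi.smul_apply, smul_eq_mul]
  have s0 (m : Fin n) (z : Fin (k + 1) → Fin n) :
      (Fin.cons m z : Fin (k + 2) → Fin n) ∘ (0 : Fin (k + 2)).succAbove = z := by
    funext j; simp
  simp only [s0, if_true, pow_zero, one_mul, pow_succ]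
  have t1 : ∑ m : Fin n, ∑ j : Fin (k + 1), ((-1 : ℝ) ^ (j : ℕ) * -1) *
      ((if m = y j then 1 else 0) * η x (Fin.cons m (y ∘ j.succAbove))) = -((k + 1) * η x y) := by
    rw [sum_comm, ← e2, ← sum_neg_distrib]
    refine sum_congr rfl fun j _ => ?_
    rw [sum_eq_single (y j)] <;> simp +contextual
  have t2 : ∑ m : Fin n, ∑ i : Fin (k + 1), ((-1 : ℝ) ^ (i : ℕ) * -1) *
      ((if x i = m then 1 else 0) * η (Fin.cons m (x ∘ i.succAbove)) y) = -((k + 1) * η x y) := by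
    rw [sum_comm, ← e1, ← sum_neg_distrib]
    refine sum_congr rfl fun j _ => ?_
    rw [sum_eq_single (x j)] <;> simp +contextual [eq_comm]
  have t3 : ∑ m : Fin n, ∑ i : Fin (k + 1), ∑ j : Fin (k + 1), ((-1 : ℝ) ^ (i : ℕ) * -1) *
      (((-1 : ℝ) ^ (j : ℕ) * -1) * ((if x i = y j then 1 else 0) *
        η (Fin.cons m (x ∘ i.succAbove)) (Fin.cons m (y ∘ j.succAbove)))) =
      ∑ i : Fin (k + 1), ∑ j : Fin (k + 1), (-1 : ℝ) ^ (i : ℕ) * ((-1 : ℝ) ^ (j : ℕ) *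
        ((if x i = y j then 1 else 0) * ∑ m : Fin n,
        η (Fin.cons m (x ∘ i.succAbove)) (Fin.cons m (y ∘ j.succAbove)))) := by
    rw [sum_comm]
    refine sum_congr rfl fun i _ => ?_
    rw [sum_comm]
    refine sum_congr rfl fun j _ => ?_
    simp only [mul_sum]
    refine sum_congr rfl fun m _ => ?_
    ring
  rw [t1, t2, t3]
  simp
  ring

lemma dinner_comm {n p q : ℕ} (α β : DForm n p q) : dinner α β = dinner β α := by
  simp only [dinner, mul_comm (α _ _)]

lemma dinner_zero_left {n p q : ℕ} (α : DForm n p q) : dinner 0 α = 0 := by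
  simp [dinner]

lemma dinner_zero_right {n p q : ℕ} (α : DForm n p q) : dinner α 0 = 0 := by
  simp [dinner]

lemma dinner_smul_right {n p q : ℕ} (c : ℝ) (α β : DForm n p q) :
    dinner α (c • β) = c * dinner α β := by
  simp only [dinner, Pi.smul_apply, smul_eq_mul, mul_left_comm _ c, ← mul_sum]

lemma dinner_sub_left {n p q : ℕ} (α β η : DForm n p q) :
    dinner (α - β) η = dinner α η - dinner β η := by
  simp only [dinner, Pi.sub_apply, sub_mul, sum_sub_distrib, mul_sub]

lemma dinner_castD_left {n p q p' q' : ℕ} (hp : p = p') (hq : q = q') (α : DForm n p q)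
    (β : DForm n p' q') : dinner (castD hp hq α) β = dinner α (castD hp.symm hq.symm β) := by
  subst hp hq
  rfl

lemma IsAlt.sub {n p q : ℕ} {α β : DForm n p q} (hα : IsAlt α) (hβ : IsAlt β) :
    IsAlt (α - β) := by
  constructor <;> intro σ x y <;>
    simp only [Pi.sub_apply, hα.1, hβ.1, hα.2, hβ.2, mul_sub]

/-- The inner product is nondegenerate on antisymmetric arrays. -/
lemma IsAlt.ext_dinner {n p q : ℕ} {α β : DForm n p q} (hα : IsAlt α) (hβ : IsAlt β)
    (h : ∀ η, IsAlt η → dinner α η = dinner β η) : α = β := by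
  have h0 := dinner_sub_left α β (α - β)
  rw [h _ (hα.sub hβ), sub_self, dinner, mul_eq_zero] at h0
  have h1 := h0.resolve_left (by positivity)
  rw [sum_eq_zero_iff_of_nonneg
    fun x _ => sum_nonneg fun y _ => mul_self_nonneg _] at h1
  funext x y
  have h2 := h1 x (mem_univ x)
  rw [sum_eq_zero_iff_of_nonneg fun y _ => mul_self_nonneg _] at h2
  exact sub_eq_zero.1 (mul_self_eq_zero.1 (h2 y (mem_univ y)))

/-- Multiplication by the metric is adjoint to contraction. -/
lemma dinner_gwedge {n k : ℕ} (η : DForm n k k) {ζ : DForm n (k + 1) (k + 1)} (hζ : IsAlt ζ) :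
    dinner (gwedge η) ζ = dinner η (contr ζ) := by
  have h1 : ∀ y, IsAltFn fun x => ζ x y := fun y σ x => hζ.1 σ x y
  have h2 : ∀ x, IsAltFn fun y => ζ x y := fun x σ y => hζ.2 σ x y
  have key (i j : Fin (k + 1)) : ∑ x : Fin (k + 1) → Fin n, ∑ y : Fin (k + 1) → Fin n,
      (-1) ^ (i : ℕ) * ((-1) ^ (j : ℕ) * ((if x i = y j then 1 else 0) *
        η (x ∘ i.succAbove) (y ∘ j.succAbove))) * ζ x y =
      ∑ u, ∑ v, η u v * contr ζ u v := by
    have hs (i : Fin (k + 1)) (m : Fin n) (u : Fin k → Fin n) :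
        (i.insertNth m u : Fin (k + 1) → Fin n) ∘ i.succAbove = u := by
      funext l; simp
    have ha (i : Fin (k + 1)) (m : Fin n) (u : Fin k → Fin n) :
        Fin.insertNthEquiv (fun _ => Fin n) i (m, u) = i.insertNth m u := rfl
    rw [← Equiv.sum_comp (Fin.insertNthEquiv (fun _ => Fin n) i), Fintype.sum_prod_type_right]
    refine sum_congr rfl fun u _ => ?_
    have : ∀ m : Fin n, ∑ y : Fin (k + 1) → Fin n,
        (-1) ^ (i : ℕ) * ((-1) ^ (j : ℕ) *
        ((if Fin.insertNthEquiv (fun _ => Fin n) i (m, u) i = y j then 1 else 0) *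
        η (Fin.insertNthEquiv (fun _ => Fin n) i (m, u) ∘ i.succAbove) (y ∘ j.succAbove))) *
          ζ (Fin.insertNthEquiv (fun _ => Fin n) i (m, u)) y =
        ∑ v, η u v * ζ (Fin.cons m u) (Fin.cons m v) := by
      intro m
      rw [← Equiv.sum_comp (Fin.insertNthEquiv (fun _ => Fin n) j), Fintype.sum_prod_type_right]
      refine sum_congr rfl fun v _ => ?_
      simp only [ha, Fin.insertNth_apply_same, hs, (h1 _).insertNth,
        (h2 _).insertNth]
      rw [sum_eq_single m (by simp +contextual [eq_comm]) (by simp)]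
      have e1 : ((-1 : ℝ) ^ (i : ℕ)) * (-1) ^ (i : ℕ) = 1 := by simp [← mul_pow]
      have e2 : ((-1 : ℝ) ^ (j : ℕ)) * (-1) ^ (j : ℕ) = 1 := by simp [← mul_pow]
      simp only [if_true]
      linear_combination (η u v * ζ (Fin.cons m u) (Fin.cons m v)) *
        ((-1) ^ (i : ℕ) * (-1) ^ (i : ℕ) * e2 + e1)
    simp only [this, contr, mul_sum]
    rw [sum_comm]
  have : ∑ x, ∑ y, gwedge η x y * ζ x y =
      ((k + 1 : ℕ) * (k + 1 : ℕ) : ℝ) * ∑ u, ∑ v, η u v * contr ζ u v := by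
    calc _ = ∑ i : Fin (k + 1), ∑ j : Fin (k + 1), ∑ x : Fin (k + 1) → Fin n,
        ∑ y : Fin (k + 1) → Fin n, (-1) ^ (i : ℕ) * ((-1) ^ (j : ℕ) *
          ((if x i = y j then 1 else 0) *
          η (x ∘ i.succAbove) (y ∘ j.succAbove))) * ζ x y := by
          simp only [gwedge, sum_mul]
          simp only [sum_comm (s := (univ : Finset (Fin (k + 1) → Fin n)))
            (t := (univ : Finset (Fin (k + 1))))]
      _ = _ := by
          simp only [key]
          simp [mul_assoc]
  rw [dinner, dinner, this, Nat.factorial_succ]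
  push_cast
  field_simp

lemma isAlt_dmul {n p q r s : ℕ} (α : DForm n p q) (β : DForm n r s) : IsAlt (dmul α β) := by
  constructor
  · intro ρ x y
    simp only [dmul]
    conv_rhs => rw [mul_left_comm, mul_sum]
    congr 1
    conv_rhs => rw [← Equiv.sum_comp (Equiv.mulLeft ρ)]
    refine sum_congr rfl fun σ _ => ?_
    rw [mul_sum]
    refine sum_congr rfl fun τ _ => ?_
    simp only [Equiv.coe_mulLeft, Equiv.Perm.sign_mul, Equiv.Perm.mul_apply, Function.comp_apply]
    push_cast
    simp only [← mul_assoc, sign_mul_self_cast, one_mul]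
  · intro ρ x y
    simp only [dmul]
    conv_rhs => rw [mul_left_comm, mul_sum]
    congr 1
    refine sum_congr rfl fun σ _ => ?_
    rw [mul_sum]
    conv_rhs => rw [← Equiv.sum_comp (Equiv.mulLeft ρ)]
    refine sum_congr rfl fun τ _ => ?_
    simp only [Equiv.coe_mulLeft, Equiv.Perm.sign_mul, Equiv.Perm.mul_apply, Function.comp_apply]
    push_cast
    rw [mul_comm ((Equiv.Perm.sign ρ : ℤ) : ℝ) ((Equiv.Perm.sign τ : ℤ) : ℝ)]
    linear_combination (-((Equiv.Perm.sign σ : ℤ) : ℝ) * ((Equiv.Perm.sign τ : ℤ) : ℝ) *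
          (α (fun i => x (σ (Fin.castAdd r i))) (fun j => y (ρ (τ (Fin.castAdd s j)))) *
           β (fun i => x (σ (Fin.natAdd p i))) (fun j => y (ρ (τ (Fin.natAdd q j)))))) *
      sign_mul_self_cast ρ

/-- Pairing a product with an antisymmetric array needs no antisymmetrization. -/
lemma dinner_dmul {n p q r s : ℕ} (α : DForm n p q) (β : DForm n r s)
    {η : DForm n (p + r) (q + s)} (hη : IsAlt η) :
    dinner (dmul α β) η = 1 / ((p.factorial * r.factorial * q.factorial * s.factorial : ℕ) : ℝ) *
      ∑ u, ∑ v, ∑ u', ∑ v', α u v * β u' v' * η (Fin.append u u') (Fin.append v v') := by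
  set F : DForm n (p + r) (q + s) := fun x y =>
    α (fun i => x (Fin.castAdd r i)) (fun j => y (Fin.castAdd s j)) *
      β (fun i => x (Fin.natAdd p i)) (fun j => y (Fin.natAdd q j)) with hF
  have key (σ : Equiv.Perm (Fin (p + r))) (τ : Equiv.Perm (Fin (q + s))) :
      ∑ x, ∑ y, ((Equiv.Perm.sign σ : ℤ) : ℝ) * ((Equiv.Perm.sign τ : ℤ) : ℝ) *
        F (x ∘ σ) (y ∘ τ) * η x y = ∑ x, ∑ y, F x y * η x y := by
    conv_rhs => rw [← Equiv.sum_comp (Equiv.arrowCongr σ.symm (Equiv.refl (Fin n)))]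
    refine sum_congr rfl fun x _ => ?_
    conv_rhs => rw [← Equiv.sum_comp (Equiv.arrowCongr τ.symm (Equiv.refl (Fin n)))]
    refine sum_congr rfl fun y _ => ?_
    have a1 : Equiv.arrowCongr σ.symm (Equiv.refl (Fin n)) x = x ∘ σ := rfl
    have a2 : Equiv.arrowCongr τ.symm (Equiv.refl (Fin n)) y = y ∘ τ := rfl
    rw [a1, a2, hη.1, hη.2]
    ring
  have total : ∑ x, ∑ y, F x y * η x y =
      ∑ u, ∑ v, ∑ u', ∑ v', α u v * β u' v' * η (Fin.append u u') (Fin.append v v') := by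
    rw [← Equiv.sum_comp (Fin.appendEquiv (α := Fin n) p r), Fintype.sum_prod_type]
    refine sum_congr rfl fun u _ => ?_
    conv_rhs => rw [sum_comm]
    refine sum_congr rfl fun u' _ => ?_
    rw [← Equiv.sum_comp (Fin.appendEquiv (α := Fin n) q s), Fintype.sum_prod_type]
    simp [hF, Fin.appendEquiv]
  rw [← total]
  have expand : ∑ x, ∑ y, dmul α β x y * η x y =
      1 / ((p.factorial * r.factorial * q.factorial * s.factorial : ℕ) : ℝ) *
      (((p + r).factorial * (q + s).factorial : ℕ) * ∑ x, ∑ y, F x y * η x y) := by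
    calc _ = 1 / ((p.factorial * r.factorial * q.factorial * s.factorial : ℕ) : ℝ) *
        ∑ σ : Equiv.Perm (Fin (p + r)), ∑ τ : Equiv.Perm (Fin (q + s)),
          ∑ x : Fin (p + r) → Fin n, ∑ y : Fin (q + s) → Fin n,
          ((Equiv.Perm.sign σ : ℤ) : ℝ) * ((Equiv.Perm.sign τ : ℤ) : ℝ) *
          F (x ∘ σ) (y ∘ τ) * η x y := by
          simp only [dmul, mul_assoc (1 / _ : ℝ), ← mul_sum]
          congr 1
          simp only [sum_mul]
          rw [sum_congr rfl fun x _ => sum_comm, sum_comm]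
          refine sum_congr rfl fun σ _ => ?_
          rw [sum_congr rfl fun x _ => sum_comm, sum_comm]
          rfl
      _ = _ := by
          simp only [key, sum_const, card_univ, Fintype.card_perm, Fintype.card_fin, nsmul_eq_mul]
          push_cast
          ring
  rw [dinner, expand]
  push_cast
  field_simp

lemma dinner_dmul_gform {n k : ℕ} (α : DForm n k k) {ζ : DForm n (k + 1) (k + 1)}
    (hζ : IsAlt ζ) :
    dinner (castD (Nat.add_comm 1 k) (Nat.add_comm 1 k) (dmul (gform n) α)) ζ =
      dinner α (contr ζ) := by
  rw [dinner_castD_left, dinner_dmul _ _ (hζ.castD _ _)]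
  have h (j : Fin n) (u : Fin k → Fin n) :
      Fin.append (fun _ : Fin 1 => j) u ∘ Fin.cast (Nat.add_comm 1 k).symm = Fin.cons j u := by
    rw [Fin.append_left_eq_cons]
    rfl
  rw [← Equiv.sum_comp (Equiv.funUnique (Fin 1) (Fin n)).symm]
  have h' (i : Fin n) : (Equiv.funUnique (Fin 1) (Fin n)).symm i = fun _ => i := rfl
  have inner (i : Fin n) : ∑ v : Fin 1 → Fin n, ∑ u', ∑ v', gform n (fun _ => i) v * α u' v' *
      castD (Nat.add_comm 1 k).symm (Nat.add_comm 1 k).symm ζ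
        (Fin.append (fun _ => i) u') (Fin.append v v') =
      ∑ u', ∑ v', α u' v' * ζ (Fin.cons i u') (Fin.cons i v') := by
    rw [← Equiv.sum_comp (Equiv.funUnique (Fin 1) (Fin n)).symm, sum_eq_single i]
    · simp [h', gform, castD, h]
    · intro j _ hj
      simp [h', gform, hj.symm]
    · simp
  simp only [h', inner, dinner, contr, mul_sum]
  rw [sum_comm]
  refine sum_congr rfl fun u _ => ?_
  rw [sum_comm]
  simp

/-- Pairing with `g^p` is the full contraction. -/
lemma dinner_gpow {n p : ℕ} {ζ : DForm n p p} (hζ : IsAlt ζ) :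
    dinner (gpow n p) ζ = ∑ z, ζ z z := by
  induction p with
  | zero => simp [dinner, gpow]
  | succ p ih =>
    rw [gpow, dinner_dmul_gform _ hζ, ih hζ.contr,
      ← Equiv.sum_comp (Fin.consEquiv fun _ => Fin n), Fintype.sum_prod_type, sum_comm]
    rfl

lemma append_comp_perm {n p r : ℕ} (u : Fin p → Fin n) (w : Fin r → Fin n)
    (σ : Equiv.Perm (Fin p)) :
    Fin.append (u ∘ σ) w =
      Fin.append u w ∘ finSumFinEquiv.permCongr (Equiv.Perm.sumCongr σ 1) := by
  funext i
  refine Fin.addCases (fun i => ?_) (fun i => ?_) i <;> simp [Equiv.permCongr_apply]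

lemma IsAlt.append {n p q r s : ℕ} {η : DForm n (p + r) (q + s)} (hη : IsAlt η)
    (u : Fin r → Fin n) (v : Fin s → Fin n) :
    IsAlt (fun x y => η (Fin.append x u) (Fin.append y v) : DForm n p q) := by
  constructor <;> intro σ x y <;> simp only [append_comp_perm, hη.1, hη.2] <;>
    simp [Equiv.Perm.sign_permCongr]

lemma dinner_gpow_dmul {n p r : ℕ} (ω : DForm n r r) {η : DForm n (p + r) (p + r)}
    (hη : IsAlt η) :
    dinner (dmul (gpow n p) ω) η = 1 / ((r.factorial * r.factorial : ℕ) : ℝ) *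
      ∑ u, ∑ v, ω u v * ∑ z, η (Fin.append z u) (Fin.append z v) := by
  rw [dinner_dmul _ _ hη]
  have key (u v : Fin r → Fin n) :
      ∑ x, ∑ y, gpow n p x y * η (Fin.append x u) (Fin.append y v) =
        ((p.factorial * p.factorial : ℕ) : ℝ) * ∑ z, η (Fin.append z u) (Fin.append z v) := by
    rw [← dinner_gpow (hη.append u v), dinner, ← mul_assoc, mul_one_div_cancel (by positivity),
      one_mul]
  have swap : ∑ x, ∑ y, ∑ u, ∑ v, gpow n p x y * ω u v * η (Fin.append x u) (Fin.append y v) =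
      ∑ u, ∑ v, ω u v * ∑ x, ∑ y, gpow n p x y * η (Fin.append x u) (Fin.append y v) := by
    rw [sum_congr rfl fun x _ => sum_comm, sum_comm]
    refine sum_congr rfl fun u _ => ?_
    rw [sum_congr rfl fun x _ => sum_comm, sum_comm]
    refine sum_congr rfl fun v _ => ?_
    simp only [mul_sum]
    refine sum_congr rfl fun x _ => sum_congr rfl fun y _ => ?_
    ring
  rw [swap]
  simp only [key, mul_left_comm (ω _ _), ← mul_sum]
  push_cast
  field_simp

/-- Multiplication by the metric on sequences of double forms indexed by their degree. -/
def raise {n : ℕ} (Ω : ∀ k, DForm n k k) : ∀ k, DForm n k k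
  | 0 => 0
  | k + 1 => gwedge (Ω k)

/-- Contraction on sequences of double forms indexed by their degree. -/
def lower {n : ℕ} (Ω : ∀ k, DForm n k k) : ∀ k, DForm n k k := fun k => contr (Ω (k + 1))

/-- The sequence with a single nonzero term, in degree `r`. -/
def homog {n r : ℕ} (ω : DForm n r r) : ∀ k, DForm n k k :=
  fun k => if h : r = k then castD h h ω else 0

lemma isAlt_homog {n r : ℕ} {ω : DForm n r r} (hω : IsAlt ω) (k : ℕ) : IsAlt (homog ω k) := by
  unfold homog
  split_ifs with h
  · exact hω.castD h h
  · exact isAlt_zero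

lemma isAlt_raise {n : ℕ} {Ω : ∀ k, DForm n k k} (hΩ : ∀ k, IsAlt (Ω k)) :
    ∀ k, IsAlt (raise Ω k)
  | 0 => isAlt_zero
  | k + 1 => (hΩ k).gwedge

lemma isAlt_iterate_raise {n : ℕ} {Ω : ∀ k, DForm n k k} (hΩ : ∀ k, IsAlt (Ω k)) (p : ℕ) :
    ∀ k, IsAlt (raise^[p] Ω k) := by
  induction p with
  | zero => exact hΩ
  | succ p ih => rw [Function.iterate_succ_apply']; exact isAlt_raise ih

lemma gwedge_zero {n k : ℕ} : gwedge (0 : DForm n k k) = 0 := by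
  funext x y
  simp [gwedge]

lemma gwedge_smul {n k : ℕ} (c : ℝ) (η : DForm n k k) : gwedge (c • η) = c • gwedge η := by
  funext x y
  simp only [gwedge, Pi.smul_apply, smul_eq_mul, mul_sum, mul_left_comm _ c]

lemma raise_smul {n : ℕ} (c : ℝ) (Ω : ∀ k, DForm n k k) : raise (c • Ω) = c • raise Ω := by
  funext k
  cases k with
  | zero => simp [raise]
  | succ k => exact gwedge_smul c (Ω k)

lemma raise_zero {n : ℕ} : raise (0 : ∀ k, DForm n k k) = 0 := by
  simpa using raise_smul 0 (0 : ∀ k, DForm n k k)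

/-- The commutation relation of contraction and multiplication by the metric. -/
lemma lower_raise {n : ℕ} {Ω : ∀ k, DForm n k k} (hΩ : ∀ k, IsAlt (Ω k)) (k : ℕ) :
    lower (raise Ω) k = ((n : ℝ) - 2 * k) • Ω k + raise (lower Ω) k := by
  cases k with
  | zero => simpa [lower, raise] using contr_gwedge_zero (Ω 0)
  | succ k => exact contr_gwedge_succ (hΩ (k + 1))

lemma lower_homog {n r : ℕ} {ω : DForm n r r}
    (h : ∀ (a : ℕ) (h : r = a + 1), contr (castD h h ω) = 0) : lower (homog ω) = 0 := by
  funext k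
  by_cases hk : r = k + 1
  · simpa [lower, homog, hk] using h k hk
  · funext x y
    simp [lower, homog, hk, contr]

lemma iterate_raise_homog_of_ne {n r : ℕ} (ω : DForm n r r) {p k : ℕ} (h : p + r ≠ k) :
    raise^[p] (homog ω) k = 0 := by
  induction p generalizing k with
  | zero => simp [homog, show r ≠ k by omega]
  | succ p ih =>
    rw [Function.iterate_succ_apply']
    cases k with
    | zero => rfl
    | succ k => rw [raise, ih (by omega), gwedge_zero]

/-- Contraction of `g^{p+1} ω` for an effective form `ω`. -/
lemma lower_iterate_raise {n r : ℕ} {ω : DForm n r r} (hω : IsAlt ω)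
    (heff : lower (homog ω) = 0) (p : ℕ) :
    lower (raise^[p + 1] (homog ω)) =
      (((p : ℝ) + 1) * ((n : ℝ) - 2 * r - p)) • raise^[p] (homog ω) := by
  have alt := isAlt_iterate_raise (isAlt_homog hω)
  have degree (p k : ℕ) : ((n : ℝ) - 2 * k) • raise^[p] (homog ω) k =
      ((n : ℝ) - 2 * (p + r)) • raise^[p] (homog ω) k := by
    by_cases h : p + r = k
    · subst h; push_cast; rfl
    · simp [iterate_raise_homog_of_ne ω h]
  induction p with
  | zero =>
    funext k
    have := degree 0 k
    simp only [Function.iterate_zero, id_eq] at this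
    rw [Function.iterate_succ_apply', lower_raise (alt 0)]
    simp only [Function.iterate_zero, id_eq]
    rw [heff, raise_zero, this]
    simp
  | succ p ih =>
    funext k
    rw [Function.iterate_succ_apply', lower_raise (alt _), ih, raise_smul, degree,
      ← Function.iterate_succ_apply' raise, Pi.smul_apply, Pi.smul_apply, ← add_smul]
    congr 1
    push_cast
    ring

lemma dinner_raise {n : ℕ} (Ω : ∀ k, DForm n k k) {Z : ∀ k, DForm n k k}
    (hZ : ∀ k, IsAlt (Z k)) (k : ℕ) :
    dinner (raise Ω (k + 1)) (Z (k + 1)) = dinner (Ω k) (lower Z k) :=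
  dinner_gwedge (Ω k) (hZ (k + 1))

lemma dinner_raise_eq_zero {n : ℕ} (Ω : ∀ k, DForm n k k) {Z : ∀ k, DForm n k k}
    (hZ : ∀ k, IsAlt (Z k)) (h : lower Z = 0) (k : ℕ) : dinner (raise Ω k) (Z k) = 0 := by
  cases k with
  | zero => exact dinner_zero_left _
  | succ k => rw [dinner_raise Ω hZ, h]; exact dinner_zero_right _

lemma dinner_iterate_raise_of_ne {n r s : ℕ} {ω₁ : DForm n r r} {ω₂ : DForm n s s}
    (h₁ : IsAlt ω₁) (h₂ : IsAlt ω₂) (e₁ : lower (homog ω₁) = 0) (e₂ : lower (homog ω₂) = 0)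
    {p q : ℕ} (hpq : p ≠ q) (k : ℕ) :
    dinner (raise^[p] (homog ω₁) k) (raise^[q] (homog ω₂) k) = 0 := by
  induction p generalizing q k with
  | zero =>
    obtain ⟨q, rfl⟩ := Nat.exists_eq_succ_of_ne_zero hpq.symm
    rw [dinner_comm, Nat.succ_eq_add_one, Function.iterate_succ_apply']
    exact dinner_raise_eq_zero _ (isAlt_homog h₁) e₁ k
  | succ p ih =>
    rw [Function.iterate_succ_apply']
    cases q with
    | zero => exact dinner_raise_eq_zero _ (isAlt_homog h₂) e₂ k
    | succ q =>
      cases k with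
      | zero => exact dinner_zero_left _
      | succ k =>
        rw [dinner_raise _ (isAlt_iterate_raise (isAlt_homog h₂) _), lower_iterate_raise h₂ e₂,
          Pi.smul_apply, dinner_smul_right, ih (by omega), mul_zero]

lemma dinner_iterate_raise_self {n r : ℕ} (Ω : ∀ k, DForm n k k) {ω : DForm n r r}
    (hω : IsAlt ω) (e : lower (homog ω) = 0) (p k : ℕ) :
    dinner (raise^[p] Ω (p + k)) (raise^[p] (homog ω) (p + k)) =
      (p.factorial : ℝ) * (∏ i ∈ Finset.range p, ((n : ℝ) - 2 * r - i)) *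
        dinner (Ω k) (homog ω k) := by
  induction p with
  | zero => rw [Nat.zero_add]; simp
  | succ p ih =>
    rw [Nat.add_right_comm, Function.iterate_succ_apply',
      dinner_raise _ (isAlt_iterate_raise (isAlt_homog hω) _), lower_iterate_raise hω e,
      Pi.smul_apply, dinner_smul_right, ih, prod_range_succ, Nat.factorial_succ]
    push_cast
    ring

lemma dinner_iterate_raise_homog {n p r k : ℕ} (ω : DForm n r r) (h : k = p + r)
    {η : DForm n k k} (hη : IsAlt η) :
    dinner (raise^[p] (homog ω) k) η = 1 / ((r.factorial * r.factorial : ℕ) : ℝ) *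
      ∑ u, ∑ v, ω u v * ∑ z, η (Fin.append z u ∘ Fin.cast h) (Fin.append z v ∘ Fin.cast h) := by
  induction p generalizing k with
  | zero =>
    obtain rfl : k = r := by omega
    have hc (z : Fin 0 → Fin n) (u : Fin k → Fin n) : Fin.append z u ∘ Fin.cast h = u := by
      rw [Subsingleton.elim z Fin.elim0, Fin.elim0_append]
      rfl
    simp only [hc]
    simp [homog, dinner, castD]
  | succ p ih =>
    obtain ⟨k, rfl⟩ : ∃ l, k = l + 1 := ⟨p + r, by omega⟩
    obtain rfl : k = p + r := by omega
    have hc (j : Fin n) (z : Fin p → Fin n) (u : Fin r → Fin n) :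
        Fin.append (Fin.cons j z : Fin (p + 1) → Fin n) u ∘ Fin.cast h =
          Fin.cons j (Fin.append z u) := by
      rw [Fin.append_cons]
      rfl
    rw [Function.iterate_succ_apply', raise, dinner_gwedge _ hη, ih rfl hη.contr]
    congr 1
    refine sum_congr rfl fun u _ => sum_congr rfl fun v _ => ?_
    rw [← Equiv.sum_comp (Fin.consEquiv fun _ => Fin n), Fintype.sum_prod_type, sum_comm]
    simp [contr, Fin.consEquiv, hc]

/-- The product with `g^p` is the `p`-fold multiplication by the metric. -/
lemma gpow_dmul_eq {n p r k : ℕ} {ω : DForm n r r} (hω : IsAlt ω) (h : p + r = k) :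
    castD h h (dmul (gpow n p) ω) = raise^[p] (homog ω) k := by
  subst h
  refine (isAlt_dmul _ _).ext_dinner (isAlt_iterate_raise (isAlt_homog hω) p _) fun η hη => ?_
  rw [dinner_iterate_raise_homog ω rfl hη]
  exact dinner_gpow_dmul ω hη

/-- Kulkarni's/Labbi's orthogonality lemma.  For effective (trace-free) double forms
`ω₁ ∈ E^{r,r}` and `ω₂ ∈ E^{s,s}` on an `n`-dimensional Euclidean space:
`⟨g^p ω₁, g^q ω₂⟩ = 0` whenever `p ≠ q`, or `p = q` and `r ≠ s`; and when
`p = q ≥ 1` and `r = s`,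
`⟨g^p ω₁, g^p ω₂⟩ = p!·∏_{i=0}^{p-1} (n - 2r - i)·⟨ω₁, ω₂⟩`. -/
theorem gpow_inner_effective (n p q r s : ℕ)
    (ω₁ : DForm n r r) (ω₂ : DForm n s s)
    (halt₁ : IsAlt ω₁) (halt₂ : IsAlt ω₂)
    (heff₁ : ∀ (a : ℕ) (h : r = a + 1), contr (castD h h ω₁) = 0)
    (heff₂ : ∀ (a : ℕ) (h : s = a + 1), contr (castD h h ω₂) = 0)
    (hdeg : p + r = q + s) :
    ((p ≠ q ∨ r ≠ s) →
      dinner (dmul (gpow n p) ω₁) (castD hdeg.symm hdeg.symm (dmul (gpow n q) ω₂)) = 0) ∧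
    (∀ (hpq : p = q) (hrs : r = s) (hp1 : 1 ≤ p),
      dinner (dmul (gpow n p) ω₁) (castD hdeg.symm hdeg.symm (dmul (gpow n q) ω₂))
        = (p.factorial : ℝ) * (∏ i ∈ Finset.range p, ((n : ℝ) - 2 * r - i)) *
            dinner ω₁ (castD hrs.symm hrs.symm ω₂)) := by
  have e₁ := lower_homog heff₁
  have e₂ := lower_homog heff₂
  rw [gpow_dmul_eq halt₂ hdeg.symm,
    show dmul (gpow n p) ω₁ = raise^[p] (homog ω₁) (p + r) from gpow_dmul_eq halt₁ rfl]
  refine ⟨fun h => dinner_iterate_raise_of_ne halt₁ halt₂ e₁ e₂ (by omega) _, ?_⟩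
  rintro rfl rfl -
  rw [dinner_iterate_raise_self _ halt₂ e₂]
  simp only [homog, dif_pos]
  rfl

end
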